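/- arXiv:math/0503228 — 3 statements merged into one kernel-verified Lean document; each statement's English description precedes it below -/
import Mathlib

section
/- Let Γ = (R,S) be a finite binary relation. Then for every p ≥ 1, the identity γ_{p,p−1}(Γ) − γ_{p+1,p−1}(Γ) + γ_{p+1,p}(Γ) = γ_{p−1,p}(Γ) − γ_{p−1,p+1}(Γ) + γ_{p,p+1}(Γ) holds. -/
open Polynomial

namespace Towber

/-- A transformation-pair over `K`: two `K`-linear maps between
finite-dimensional `K`-vector spaces. -/
structure Pair (K : Type) [Field K] where
  E : Type
  V : Type
  [addE : AddCommGroup E]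
  [modE : Module K E]
  [finE : FiniteDimensional K E]
  [addV : AddCommGroup V]
  [modV : Module K V]
  [finV : FiniteDimensional K V]
  mu : E →ₗ[K] V
  nu : E →ₗ[K] V

attribute [instance] Pair.addE Pair.modE Pair.finE Pair.addV Pair.modV Pair.finV

variable (K : Type) [Field K]

/-- Isomorphism of transformation-pairs. -/
def Pair.Iso (τ σ : Pair K) : Prop :=
  ∃ (α : τ.E ≃ₗ[K] σ.E) (β : τ.V ≃ₗ[K] σ.V),
    (∀ x, σ.mu (α x) = β (τ.mu x)) ∧ (∀ x, σ.nu (α x) = β (τ.nu x))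

/-- Finite direct sum of transformation-pairs. -/
noncomputable def dSum (ι : Type) [Finite ι] (τ : ι → Pair K) : Pair K :=
  letI := Fintype.ofFinite ι
  { E := ∀ i, (τ i).E
    V := ∀ i, (τ i).V
    mu := LinearMap.pi fun i => (τ i).mu ∘ₗ LinearMap.proj i
    nu := LinearMap.pi fun i => (τ i).nu ∘ₗ LinearMap.proj i }

/-- Binary direct sum of transformation-pairs. -/
noncomputable def dSum2 (τ σ : Pair K) : Pair K where
  E := τ.E × σ.E
  V := τ.V × σ.V
  mu := τ.mu.prodMap σ.mu
  nu := τ.nu.prodMap σ.nu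

/-- A transformation-pair built from a pair of matrices. -/
noncomputable def ofMats {a b : ℕ} (M N : Matrix (Fin b) (Fin a) K) : Pair K where
  E := Fin a → K
  V := Fin b → K
  mu := Matrix.toLin' M
  nu := Matrix.toLin' N

/-- `^0T_n = [μ_n, I : K^n → K^n]`, where `μ_n` maps `f_i ↦ f_{i+1}`, `f_n ↦ 0`. -/
noncomputable def zT (n : ℕ) : Pair K :=
  ofMats K (Matrix.of fun j i : Fin n => if (i : ℕ) + 1 = (j : ℕ) then 1 else 0) 1

/-- `T^0_n = [I, μ_n : K^n → K^n]`. -/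
noncomputable def Tz (n : ℕ) : Pair K :=
  ofMats K 1 (Matrix.of fun j i : Fin n => if (i : ℕ) + 1 = (j : ℕ) then 1 else 0)

/-- `T_n = [κ_n, λ_n : K^n → K^{n+1}]`, `κ_n : f_i ↦ f_i`, `λ_n : f_i ↦ f_{i+1}`. -/
noncomputable def Tn (n : ℕ) : Pair K :=
  ofMats K (Matrix.of fun (j : Fin (n+1)) (i : Fin n) => if (j : ℕ) = (i : ℕ) then 1 else 0)
    (Matrix.of fun (j : Fin (n+1)) (i : Fin n) => if (j : ℕ) = (i : ℕ) + 1 then 1 else 0)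

/-- `^0T^0_n = [κ'_n, λ'_n : K^{n+1} → K^n]`. -/
noncomputable def zTz (n : ℕ) : Pair K :=
  ofMats K (Matrix.of fun (j : Fin n) (i : Fin (n+1)) => if (j : ℕ) = (i : ℕ) then 1 else 0)
    (Matrix.of fun (j : Fin n) (i : Fin (n+1)) => if (j : ℕ) + 1 = (i : ℕ) then 1 else 0)

/-- `S(F) = [·X, I : K[X]/(F) → K[X]/(F)]` for a nonzero polynomial `F`. -/
noncomputable def SP (F : Polynomial K) (hF : F ≠ 0) : Pair K :=
  letI : FiniteDimensional K (AdjoinRoot F) := (AdjoinRoot.powerBasis hF).finite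
  { E := AdjoinRoot F
    V := AdjoinRoot F
    mu := LinearMap.mulLeft K (AdjoinRoot.root F)
    nu := LinearMap.id }

/-- Membership in Kronecker's list `L(K)` (up to isomorphism). -/
def IsKron (σ : Pair K) : Prop :=
  (∃ n, 1 ≤ n ∧ Pair.Iso K σ (zT K n)) ∨
  (∃ n, 1 ≤ n ∧ Pair.Iso K σ (Tz K n)) ∨
  (∃ n, Pair.Iso K σ (Tn K n)) ∨
  (∃ n, Pair.Iso K σ (zTz K n)) ∨
  (∃ (p : Polynomial K) (n : ℕ), p.Monic ∧ Irreducible p ∧ p ≠ X ∧ 1 ≤ n ∧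
    ∃ h : p ^ n ≠ 0, Pair.Iso K σ (SP K (p ^ n) h))

/-- Being of type `S(p^n)` with `p` monic irreducible, `p ≠ X`, `n ≥ 1`. -/
def IsSType (σ : Pair K) : Prop :=
  ∃ (p : Polynomial K) (n : ℕ), p.Monic ∧ Irreducible p ∧ p ≠ X ∧ 1 ≤ n ∧
    ∃ h : p ^ n ≠ 0, Pair.Iso K σ (SP K (p ^ n) h)

/-- Membership in Weierstrass' (regular) part of Kronecker's list. -/
def IsKronReg (σ : Pair K) : Prop :=
  (∃ n, 1 ≤ n ∧ Pair.Iso K σ (zT K n)) ∨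
  (∃ n, 1 ≤ n ∧ Pair.Iso K σ (Tz K n)) ∨
  (∃ (p : Polynomial K) (n : ℕ), p.Monic ∧ Irreducible p ∧ p ≠ X ∧ 1 ≤ n ∧
    ∃ h : p ^ n ≠ 0, Pair.Iso K σ (SP K (p ^ n) h))

/-- A finite binary relation `(R, S)`. -/
structure BRel where
  S : Type
  R : S → S → Prop
  [fin : Finite S]

attribute [instance] BRel.fin

/-- The generating relation for left contraction:
`y ~ y'` whenever `∃ x, xRy ∧ xRy'`. -/
def BRel.lgen (Γ : BRel) : Γ.S → Γ.S → Prop := fun y y' => ∃ x, Γ.R x y ∧ Γ.R x y'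

/-- The generating relation for right contraction:
`x ~ x'` whenever `∃ y, xRy ∧ x'Ry`. -/
def BRel.rgen (Γ : BRel) : Γ.S → Γ.S → Prop := fun x x' => ∃ y, Γ.R x y ∧ Γ.R x' y

/-- Quotient of a binary relation by (the equivalence relation generated by) `r`:
two classes are related iff some representatives are related. -/
def BRel.quotBy (Γ : BRel) (r : Γ.S → Γ.S → Prop) : BRel where
  S := Quot r
  R := fun α β => ∃ a b, Quot.mk r a = α ∧ Quot.mk r b = β ∧ Γ.R a b

/-- Left contraction `C_l Γ`. -/
def BRel.Cl (Γ : BRel) : BRel := Γ.quotBy Γ.lgen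

/-- Right contraction `C_r Γ`. -/
def BRel.Cr (Γ : BRel) : BRel := Γ.quotBy Γ.rgen

/-- Graph-isomorphism of binary relations. -/
def BRel.Iso (Γ Δ : BRel) : Prop :=
  ∃ φ : Γ.S ≃ Δ.S, ∀ a b, Δ.R (φ a) (φ b) ↔ Γ.R a b

/-- `γ_{m,n}(Γ)`, the number of vertices of `C_l^m C_r^n Γ`. -/
noncomputable def BRel.gamma (Γ : BRel) (m n : ℕ) : ℕ :=
  Nat.card ((BRel.Cl^[m] (BRel.Cr^[n] Γ)).S)

/-- `Γ` has stabilized at `N`: for all `m, n ≥ N` the iterated contraction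
`C_l^m C_r^n Γ` is graph-isomorphic to `C_l^N C_r^N Γ`. -/
def BRel.StabAt (Γ : BRel) (N : ℕ) : Prop :=
  ∀ m, N ≤ m → ∀ n, N ≤ n →
    BRel.Iso (BRel.Cl^[m] (BRel.Cr^[n] Γ)) (BRel.Cl^[N] (BRel.Cr^[N] Γ))

/-- Number of edges of a binary relation. -/
noncomputable def BRel.edges (Γ : BRel) : ℕ :=
  Nat.card {p : Γ.S × Γ.S // Γ.R p.1 p.2}

/-- The `K`-linearization of a finite binary relation. -/
noncomputable def BRel.linz (Γ : BRel) : Pair K :=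
  letI := Fintype.ofFinite Γ.S
  letI := Classical.decEq Γ.S
  letI : DecidablePred (fun p : Γ.S × Γ.S => Γ.R p.1 p.2) := Classical.decPred _
  { E := {p : Γ.S × Γ.S // Γ.R p.1 p.2} → K
    V := Γ.S → K
    mu := Matrix.toLin' (Matrix.of fun (v : Γ.S) (e : {p : Γ.S × Γ.S // Γ.R p.1 p.2}) =>
      if e.1.1 = v then 1 else 0)
    nu := Matrix.toLin' (Matrix.of fun (v : Γ.S) (e : {p : Γ.S × Γ.S // Γ.R p.1 p.2}) =>
      if e.1.2 = v then 1 else 0) }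

/-- The disjoint union of the paths `L_{m i}` (on `m i` vertices) and the
cycles `C_{c j}` (on `c j` vertices). -/
def modelGraph (p q : ℕ) (m : Fin p → ℕ) (c : Fin q → ℕ) : BRel where
  S := (Σ i, Fin (m i)) ⊕ (Σ j, Fin (c j))
  R := fun x y =>
    (∃ (i : Fin p) (a b : Fin (m i)),
        x = Sum.inl ⟨i, a⟩ ∧ y = Sum.inl ⟨i, b⟩ ∧ (b : ℕ) = (a : ℕ) + 1) ∨
    (∃ (j : Fin q) (a b : Fin (c j)),
        x = Sum.inr ⟨j, a⟩ ∧ y = Sum.inr ⟨j, b⟩ ∧ (b : ℕ) = ((a : ℕ) + 1) % (c j))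

/-- A finite directed graph, possibly with parallel edges. -/
structure DiGraph where
  E : Type
  V : Type
  [finE : Finite E]
  [finV : Finite V]
  init : E → V
  term : E → V

attribute [instance] DiGraph.finE DiGraph.finV

/-- The parallelism relation on the edges of a directed graph. -/
def DiGraph.par (G : DiGraph) : G.E → G.E → Prop :=
  fun e e' => G.init e = G.init e' ∧ G.term e = G.term e'

/-- The reduced form of a directed graph: edges are parallelism classes. -/
def DiGraph.red (G : DiGraph) : DiGraph where
  E := Quot G.par
  V := G.V
  init := Quot.lift G.init fun _ _ h => h.1
  term := Quot.lift G.term fun _ _ h => h.2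

/-- The `K`-linearization of a finite directed graph. -/
noncomputable def DiGraph.linz (G : DiGraph) : Pair K :=
  letI := Fintype.ofFinite G.E
  letI := Fintype.ofFinite G.V
  letI := Classical.decEq G.V
  letI := Classical.decEq G.E
  { E := G.E → K
    V := G.V → K
    mu := Matrix.toLin' (Matrix.of fun (v : G.V) (e : G.E) => if G.init e = v then 1 else 0)
    nu := Matrix.toLin' (Matrix.of fun (v : G.V) (e : G.E) => if G.term e = v then 1 else 0) }

namespace BRel

/-- The vertices of `Γ` that are the target of some edge. -/
def targets (Γ : BRel) : Set Γ.S := {y | ∃ x, Γ.R x y}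

/-- The opposite relation. -/
def op (Γ : BRel) : BRel where
  S := Γ.S
  R := fun x y => Γ.R y x

/-- The number of zigzag components of edges of `Γ`; each of them has exactly one target
in `C_l Γ`. -/
noncomputable def numComponents (Γ : BRel) : ℕ := Γ.Cl.targets.ncard

/-- A map exhibiting `Δ` as the quotient of `Γ` by the kernel of the map. -/
def IsQuotMap {Γ Δ : BRel} (f : Γ.S → Δ.S) : Prop :=
  Function.Surjective f ∧ ∀ α β, Δ.R α β ↔ ∃ a b, f a = α ∧ f b = β ∧ Γ.R a b

theorem isQuotMap_mk (Γ : BRel) (r : Γ.S → Γ.S → Prop) :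
    IsQuotMap (Δ := Γ.quotBy r) (Quot.mk r) :=
  ⟨Quot.mk_surjective, fun _ _ => Iff.rfl⟩

theorem IsQuotMap.comp {Γ Δ Θ : BRel} {f : Γ.S → Δ.S} {g : Δ.S → Θ.S}
    (hg : IsQuotMap g) (hf : IsQuotMap f) : IsQuotMap (g ∘ f) := by
  refine ⟨hg.1.comp hf.1, fun α β => ?_⟩
  rw [hg.2]
  constructor
  · rintro ⟨c, d, rfl, rfl, h⟩
    obtain ⟨a, b, rfl, rfl, hab⟩ := (hf.2 _ _).1 h
    exact ⟨a, b, rfl, rfl, hab⟩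
  · rintro ⟨a, b, rfl, rfl, h⟩
    exact ⟨f a, f b, rfl, rfl, (hf.2 _ _).2 ⟨a, b, rfl, rfl, h⟩⟩

/-- Two quotients of the same relation with the same kernel are isomorphic. -/
theorem IsQuotMap.iso {Γ Δ Θ : BRel} {f : Γ.S → Δ.S} {g : Γ.S → Θ.S}
    (hf : IsQuotMap f) (hg : IsQuotMap g) (h : ∀ a b, f a = f b ↔ g a = g b) :
    Iso Δ Θ := by
  choose s hs using hf.1
  have hgs : ∀ a, g (s (f a)) = g a := fun a => (h _ _).1 (hs _)
  have hbij : Function.Bijective (fun x => g (s x)) := by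
    constructor
    · intro x y hxy
      rw [← hs x, ← hs y]
      exact (h _ _).2 hxy
    · intro z
      obtain ⟨a, rfl⟩ := hg.1 z
      exact ⟨f a, hgs a⟩
  refine ⟨Equiv.ofBijective _ hbij, fun x y => ?_⟩
  rw [hg.2, hf.2]
  constructor
  · rintro ⟨a, b, ha, hb, hab⟩
    refine ⟨a, b, ?_, ?_, hab⟩
    · rw [← hs x]; exact (h _ _).2 ha
    · rw [← hs y]; exact (h _ _).2 hb
  · rintro ⟨a, b, rfl, rfl, hab⟩
    exact ⟨a, b, (hgs a).symm, (hgs b).symm, hab⟩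

theorem Iso.refl (Γ : BRel) : Iso Γ Γ := ⟨Equiv.refl _, fun _ _ => Iff.rfl⟩

theorem Iso.trans {Γ Δ Θ : BRel} (h : Iso Γ Δ) (h' : Iso Δ Θ) : Iso Γ Θ := by
  obtain ⟨φ, hφ⟩ := h
  obtain ⟨ψ, hψ⟩ := h'
  exact ⟨φ.trans ψ, fun a b => (hψ _ _).trans (hφ a b)⟩

theorem Iso.card_eq {Γ Δ : BRel} (h : Iso Γ Δ) : Nat.card Γ.S = Nat.card Δ.S := by
  obtain ⟨φ, -⟩ := h
  exact Nat.card_congr φ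

theorem Iso.quotBy {Γ Δ : BRel} (φ : Γ.S ≃ Δ.S) (hφ : ∀ a b, Δ.R (φ a) (φ b) ↔ Γ.R a b)
    {r : Γ.S → Γ.S → Prop} {r' : Δ.S → Δ.S → Prop} (hr : ∀ a b, r a b ↔ r' (φ a) (φ b)) :
    Iso (Γ.quotBy r) (Δ.quotBy r') := by
  have hφq : IsQuotMap φ := by
    refine ⟨φ.surjective, fun α β => ⟨fun h => ⟨φ.symm α, φ.symm β, by simp, by simp, ?_⟩, ?_⟩⟩
    · simpa [← hφ] using h
    · rintro ⟨a, b, rfl, rfl, h⟩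
      exact (hφ a b).2 h
  refine (isQuotMap_mk Γ r).iso ((isQuotMap_mk Δ r').comp hφq) fun a b => ?_
  exact (Quot.congr φ hr).injective.eq_iff.symm

theorem Iso.Cl {Γ Δ : BRel} (h : Iso Γ Δ) : Iso Γ.Cl Δ.Cl := by
  obtain ⟨φ, hφ⟩ := h
  refine Iso.quotBy φ hφ fun a b => ?_
  simp only [lgen, ← hφ]
  exact φ.exists_congr_left.trans (by simp)

theorem Iso.Cr {Γ Δ : BRel} (h : Iso Γ Δ) : Iso Γ.Cr Δ.Cr := by
  obtain ⟨φ, hφ⟩ := h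
  refine Iso.quotBy φ hφ fun a b => ?_
  simp only [rgen, ← hφ]
  exact φ.exists_congr_left.trans (by simp)

theorem Iso.ncard_targets {Γ Δ : BRel} (h : Iso Γ Δ) : Γ.targets.ncard = Δ.targets.ncard := by
  obtain ⟨φ, hφ⟩ := h
  rw [← Set.ncard_image_of_injective _ φ.injective]
  congr 1
  ext y
  constructor
  · rintro ⟨b, ⟨a, hab⟩, rfl⟩
    exact ⟨φ a, (hφ a b).2 hab⟩
  · rintro ⟨x, hxy⟩
    exact ⟨φ.symm y, ⟨φ.symm x, by simpa [← hφ] using hxy⟩, by simp⟩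

theorem Iso.numComponents_eq {Γ Δ : BRel} (h : Iso Γ Δ) :
    Γ.numComponents = Δ.numComponents :=
  h.Cl.ncard_targets

theorem op_Cr (Γ : BRel) : Γ.Cr.op = Γ.op.Cl := by
  change BRel.mk _ _ = BRel.mk _ _
  congr 1
  funext α β
  refine propext ⟨?_, ?_⟩
  · rintro ⟨a, b, ha, hb, h⟩
    exact ⟨b, a, hb, ha, h⟩
  · rintro ⟨a, b, ha, hb, h⟩
    exact ⟨b, a, hb, ha, h⟩

/-- Two edges whose targets are identified by `C_l` have sources identified by `C_r`. -/
theorem mk_rgen_eq_of_mk_lgen_eq {Γ : BRel} {a b a' b' : Γ.S} (h : Γ.R a b) (h' : Γ.R a' b')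
    (hb : Quot.mk Γ.lgen b = Quot.mk Γ.lgen b') : Quot.mk Γ.rgen a = Quot.mk Γ.rgen a' := by
  have key : ∀ y y', Γ.lgen y y' →
      {α | ∃ x, Γ.R x y ∧ Quot.mk Γ.rgen x = α} = {α | ∃ x, Γ.R x y' ∧ Quot.mk Γ.rgen x = α} := by
    rintro y y' ⟨x, hy, hy'⟩
    ext α
    constructor
    · rintro ⟨z, hz, rfl⟩
      exact ⟨x, hy', Quot.sound ⟨y, hy, hz⟩⟩
    · rintro ⟨z, hz, rfl⟩
      exact ⟨x, hy, Quot.sound ⟨y', hy', hz⟩⟩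
  have hset := congrArg (Quot.lift _ key) hb
  obtain ⟨x, hx, hxa⟩ := hset.subset ⟨a, h, rfl⟩
  exact hxa.symm.trans (Quot.sound ⟨b', hx, h'⟩)

/-- Two edges whose sources are identified by `C_r` have targets identified by `C_l`. -/
theorem mk_lgen_eq_of_mk_rgen_eq {Γ : BRel} {a b a' b' : Γ.S} (h : Γ.R a b) (h' : Γ.R a' b')
    (ha : Quot.mk Γ.rgen a = Quot.mk Γ.rgen a') : Quot.mk Γ.lgen b = Quot.mk Γ.lgen b' :=
  mk_rgen_eq_of_mk_lgen_eq (Γ := Γ.op) h h' ha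

theorem numComponents_op (Γ : BRel) : Γ.op.numComponents = Γ.numComponents := by
  let E := {e : Γ.S × Γ.S // Γ.R e.1 e.2}
  let src : E → Γ.op.Cl.S := fun e => Quot.mk Γ.rgen e.1.1
  let tgt : E → Γ.Cl.S := fun e => Quot.mk Γ.lgen e.1.2
  have hsrc : Γ.op.Cl.targets = Set.range src := by
    ext α
    constructor
    · rintro ⟨-, b, a, -, rfl, h⟩
      exact ⟨⟨(a, b), h⟩, rfl⟩
    · rintro ⟨⟨⟨a, b⟩, h⟩, rfl⟩
      exact ⟨_, b, a, rfl, rfl, h⟩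
  have htgt : Γ.Cl.targets = Set.range tgt := by
    ext α
    constructor
    · rintro ⟨-, a, b, -, rfl, h⟩
      exact ⟨⟨(a, b), h⟩, rfl⟩
    · rintro ⟨⟨⟨a, b⟩, h⟩, rfl⟩
      exact ⟨_, a, b, rfl, rfl, h⟩
  have hker : Setoid.ker src = Setoid.ker tgt := by
    ext e e'
    exact ⟨mk_lgen_eq_of_mk_rgen_eq e.2 e'.2, mk_rgen_eq_of_mk_lgen_eq e.2 e'.2⟩
  have hs := Nat.card_congr (Setoid.quotientKerEquivRange src)
  have ht := Nat.card_congr (Setoid.quotientKerEquivRange tgt)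
  rw [numComponents, numComponents, hsrc, htgt, ← Nat.card_coe_set_eq, ← Nat.card_coe_set_eq,
    ← hs, ← ht, hker]

/-- `C_l` identifies a vertex that is not a target with no other vertex. -/
theorem eq_of_mk_lgen_eq {Γ : BRel} {y y' : Γ.S} (hy : y ∉ Γ.targets)
    (h : Quot.mk Γ.lgen y' = Quot.mk Γ.lgen y) : y' = y := by
  have key : ∀ a b, Γ.lgen a b → (a = y) = (b = y) := by
    rintro a b ⟨x, ha, hb⟩
    refine propext ⟨?_, ?_⟩
    · rintro rfl
      exact (hy ⟨x, ha⟩).elim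
    · rintro rfl
      exact (hy ⟨x, hb⟩).elim
  exact (congrArg (Quot.lift _ key) h).mpr rfl

theorem ncard_compl_targets_Cl (Γ : BRel) : Γ.Cl.targetsᶜ.ncard = Γ.targetsᶜ.ncard := by
  have himage : Γ.Cl.targetsᶜ = Quot.mk Γ.lgen '' Γ.targetsᶜ := by
    ext α
    constructor
    · intro hα
      obtain ⟨y, rfl⟩ := Quot.exists_rep α
      refine ⟨y, ?_, rfl⟩
      rintro ⟨x, hx⟩
      exact hα ⟨_, x, y, rfl, rfl, hx⟩
    · rintro ⟨y, hy, rfl⟩ ⟨-, a, b, -, hb, h⟩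
      obtain rfl := eq_of_mk_lgen_eq hy hb
      exact hy ⟨a, h⟩
  rw [himage]
  exact Set.InjOn.ncard_image fun y _ y' hy' h => eq_of_mk_lgen_eq hy' h

/-- The vertices lost in the second of two left contractions are as many as the components
lost in the first. -/
theorem card_Cl_Cl (Γ : BRel) :
    Nat.card Γ.Cl.Cl.S + Γ.numComponents = Nat.card Γ.Cl.S + Γ.Cl.numComponents := by
  have h := ncard_compl_targets_Cl Γ.Cl
  have h₁ := Set.ncard_add_ncard_compl Γ.Cl.targets
  have h₂ := Set.ncard_add_ncard_compl Γ.Cl.Cl.targets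
  unfold numComponents
  omega

theorem card_Cr_Cr (Γ : BRel) :
    Nat.card Γ.Cr.Cr.S + Γ.numComponents = Nat.card Γ.Cr.S + Γ.Cr.numComponents := by
  have h := card_Cl_Cl Γ.op
  rw [← op_Cr, ← op_Cr, numComponents_op, numComponents_op] at h
  exact h

theorem iso_Cl_Cr (Γ : BRel) : Iso Γ.Cr.Cl Γ.Cl.Cr := by
  let f : Γ.S → Γ.Cr.Cl.S := fun a => Quot.mk Γ.Cr.lgen (Quot.mk Γ.rgen a)
  let g : Γ.S → Γ.Cl.Cr.S := fun a => Quot.mk Γ.Cl.rgen (Quot.mk Γ.lgen a)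
  have hf : IsQuotMap f := (isQuotMap_mk Γ.Cr _).comp (isQuotMap_mk Γ _)
  have hg : IsQuotMap g := (isQuotMap_mk Γ.Cl _).comp (isQuotMap_mk Γ _)
  have fr : ∀ a b, Γ.rgen a b → f a = f b := fun a b h =>
    congrArg (Quot.mk Γ.Cr.lgen) (Quot.sound h)
  have gl : ∀ a b, Γ.lgen a b → g a = g b := fun a b h =>
    congrArg (Quot.mk Γ.Cl.rgen) (Quot.sound h)
  have fl : ∀ a b, Γ.lgen a b → f a = f b := by
    rintro a b ⟨x, ha, hb⟩
    exact Quot.sound ⟨Quot.mk _ x, ⟨x, a, rfl, rfl, ha⟩, ⟨x, b, rfl, rfl, hb⟩⟩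
  have gr : ∀ a b, Γ.rgen a b → g a = g b := by
    rintro a b ⟨x, ha, hb⟩
    exact Quot.sound ⟨Quot.mk _ x, ⟨a, x, rfl, rfl, ha⟩, ⟨b, x, rfl, rfl, hb⟩⟩
  have hgf : ∀ α β : Γ.Cr.S, Γ.Cr.lgen α β → Quot.lift g gr α = Quot.lift g gr β := by
    rintro - - ⟨ξ, ⟨a, b, ha, rfl, h⟩, ⟨a', b', ha', rfl, h'⟩⟩
    exact congrArg (Quot.mk Γ.Cl.rgen) (mk_lgen_eq_of_mk_rgen_eq h h' (ha.trans ha'.symm))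
  have hfg : ∀ α β : Γ.Cl.S, Γ.Cl.rgen α β → Quot.lift f fl α = Quot.lift f fl β := by
    rintro - - ⟨ξ, ⟨a, b, rfl, hb, h⟩, ⟨a', b', rfl, hb', h'⟩⟩
    exact congrArg (Quot.mk Γ.Cr.lgen) (mk_rgen_eq_of_mk_lgen_eq h h' (hb.trans hb'.symm))
  exact hf.iso hg fun a b =>
    ⟨fun h => congrArg (Quot.lift _ hgf) h, fun h => congrArg (Quot.lift _ hfg) h⟩

theorem iso_iterate_Cl_Cr (Γ : BRel) (m : ℕ) : Iso (BRel.Cl^[m] Γ.Cr) (BRel.Cl^[m] Γ).Cr := by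
  induction m with
  | zero => exact Iso.refl _
  | succ m ih =>
    rw [Function.iterate_succ_apply', Function.iterate_succ_apply']
    exact ih.Cl.trans (iso_Cl_Cr _)

/-- The case `p = 1` of the identity between the numbers `γ_{m,n}`. -/
theorem card_contractions (Γ : BRel) :
    (Nat.card Γ.Cl.S : ℤ) - Nat.card Γ.Cl.Cl.S + Nat.card Γ.Cr.Cl.Cl.S =
      Nat.card Γ.Cr.S - Nat.card Γ.Cr.Cr.S + Nat.card Γ.Cr.Cr.Cl.S := by
  have h₁ := card_Cl_Cl Γ
  have h₂ := card_Cl_Cl Γ.Cr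
  have h₃ := card_Cr_Cr Γ
  have h₄ := card_Cr_Cr Γ.Cl
  have h₅ := ((iso_Cl_Cr Γ.Cr).trans (iso_Cl_Cr Γ).Cr).card_eq
  have h₆ := (iso_Cl_Cr Γ).card_eq
  have h₇ := (iso_Cl_Cr Γ).numComponents_eq
  omega

end BRel

/-- For `p ≥ 1`:
`γ_{p,p−1} − γ_{p+1,p−1} + γ_{p+1,p} = γ_{p−1,p} − γ_{p−1,p+1} + γ_{p,p+1}`. -/
theorem stmt9 (Γ : BRel) (p : ℕ) (hp : 1 ≤ p) :
    (Γ.gamma p (p-1) : ℤ) - (Γ.gamma (p+1) (p-1) : ℤ) + (Γ.gamma (p+1) p : ℤ) =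
      (Γ.gamma (p-1) p : ℤ) - (Γ.gamma (p-1) (p+1) : ℤ) + (Γ.gamma p (p+1) : ℤ) := by
  obtain ⟨q, rfl⟩ := Nat.exists_eq_add_of_le' hp
  have h₁ := BRel.iso_iterate_Cl_Cr (BRel.Cr^[q] Γ) q
  have h₂ := (BRel.iso_iterate_Cl_Cr (BRel.Cr^[q] Γ).Cr q).trans h₁.Cr
  have h := BRel.card_contractions (BRel.Cl^[q] (BRel.Cr^[q] Γ))
  rw [← h₁.card_eq, ← h₂.card_eq, ← h₁.Cl.Cl.card_eq, ← h₂.Cl.card_eq] at h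
  simpa only [BRel.gamma, Nat.add_sub_cancel, Function.iterate_succ_apply'] using h

end Towber
end

section
/- Let K be a field, let Γ = (R,S) be a finite binary relation whose C-stabilization C^{∞,∞}Γ is the disjoint union of path components L_{m_1}, …, L_{m_p} and cycle components C_{n_1}, …, C_{n_q}, and suppose the K-linearization K(Γ) is isomorphic to a finite direct sum of members of Kronecker's list L(K). Then the direct sum of those summands which are of type S(p(X)^n) (p monic irreducible, p ≠ X, n ≥ 1) is isomorphic, as a transformation-pair, to ⊕_{i=1}^q S(X^{n_i} − 1), where for a monic polynomial F ∈ K[X], S(F) denotes the transformation-pair [φ, I : K[X]/(F) → K[X]/(F)] with φ induced by multiplication by X. -/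
open Polynomial

namespace Towber

variable (K : Type) [Field K]

section AutSpace

variable {K}

variable (K) in
/-- A vector space equipped with a linear automorphism. -/
structure AutSpace where
  N : Type
  [addN : AddCommGroup N]
  [modN : Module K N]
  x : N ≃ₗ[K] N

attribute [instance] AutSpace.addN AutSpace.modN

/-- Linear maps commuting with the given automorphisms. -/
def Equivariant (A B : AutSpace K) (h : A.N →ₗ[K] B.N) : Prop :=
  ∀ v, h (A.x v) = B.x (h v)

lemma Equivariant.comp {A B C : AutSpace K} {h : B.N →ₗ[K] C.N} {g : A.N →ₗ[K] B.N}
    (hh : Equivariant B C h) (hg : Equivariant A B g) : Equivariant A C (h ∘ₗ g) :=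
  fun v => by simp [hg v, hh (g v)]

lemma Equivariant.id (A : AutSpace K) : Equivariant A A LinearMap.id := fun _ => rfl

variable {E V : Type} [AddCommGroup E] [Module K E] [AddCommGroup V] [Module K V]

/-- Maps `g` to a space with automorphism `x` satisfying `g ∘ mu = x ∘ g ∘ nu`. -/
def Coequalizes (mu nu : E →ₗ[K] V) (A : AutSpace K) (g : V →ₗ[K] A.N) : Prop :=
  ∀ e, g (mu e) = A.x (g (nu e))

/-- `A` is the universal space with automorphism receiving a map coequalizing `mu` and `nu`;
equivalently, it is the cokernel of `mu - X nu` over the Laurent polynomials. -/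
def IsCoker (mu nu : E →ₗ[K] V) (A : AutSpace K) (g : V →ₗ[K] A.N) : Prop :=
  Coequalizes mu nu A g ∧ ∀ (P : AutSpace K) (f : V →ₗ[K] P.N), Coequalizes mu nu P f →
    ∃! h : A.N →ₗ[K] P.N, Equivariant A P h ∧ h ∘ₗ g = f

lemma IsCoker.of_iso {τ σ : Pair K} (h : Pair.Iso K τ σ) {A : AutSpace K}
    {g : σ.V →ₗ[K] A.N} (hg : IsCoker σ.mu σ.nu A g) :
    ∃ g', IsCoker τ.mu τ.nu A g' := by
  obtain ⟨α, β, h1, h2⟩ := h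
  refine ⟨g ∘ₗ β.toLinearMap, fun e => ?_, fun P f hf => ?_⟩
  · simpa [← h1, ← h2] using hg.1 (α e)
  · obtain ⟨h, ⟨hh, hhf⟩, hu⟩ := hg.2 P (f ∘ₗ β.symm.toLinearMap) (fun e => by
      obtain ⟨e, rfl⟩ := α.surjective e
      simpa [h1, h2] using hf e)
    refine ⟨h, ⟨hh, ?_⟩, fun k hk => hu k ⟨hk.1, ?_⟩⟩
    · ext v
      simpa using LinearMap.congr_fun hhf (β v)
    · ext v
      simpa using LinearMap.congr_fun hk.2 (β.symm v)

lemma IsCoker.unique {mu nu : E →ₗ[K] V} {A B : AutSpace K} {g : V →ₗ[K] A.N}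
    {g' : V →ₗ[K] B.N} (hA : IsCoker mu nu A g) (hB : IsCoker mu nu B g') :
    ∃ (u : A.N →ₗ[K] B.N) (v : B.N →ₗ[K] A.N), Equivariant A B u ∧ Equivariant B A v ∧
      v ∘ₗ u = LinearMap.id ∧ u ∘ₗ v = LinearMap.id := by
  obtain ⟨u, ⟨hu, hug⟩, -⟩ := hA.2 B g' hB.1
  obtain ⟨v, ⟨hv, hvg⟩, -⟩ := hB.2 A g hA.1
  refine ⟨u, v, hu, hv, ?_, ?_⟩
  · exact (hA.2 A g hA.1).unique ⟨hv.comp hu, by rw [LinearMap.comp_assoc, hug, hvg]⟩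
      ⟨Equivariant.id A, rfl⟩
  · exact (hB.2 B g' hB.1).unique ⟨hu.comp hv, by rw [LinearMap.comp_assoc, hvg, hug]⟩
      ⟨Equivariant.id B, rfl⟩

/-- `A` is an equivariant retract of `N` containing the image of every equivariant map to `N`
from a finite-dimensional space. -/
def IsCore (N A : AutSpace K) : Prop :=
  FiniteDimensional K A.N ∧ ∃ (i : A.N →ₗ[K] N.N) (r : N.N →ₗ[K] A.N),
    Equivariant A N i ∧ Equivariant N A r ∧ r ∘ₗ i = LinearMap.id ∧
    ∀ (B : AutSpace K), FiniteDimensional K B.N → ∀ φ : B.N →ₗ[K] N.N, Equivariant B N φ →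
      ∀ b, i (r (φ b)) = φ b

lemma IsCore.unique {N N' A A' : AutSpace K} (hA : IsCore N A) (hA' : IsCore N' A')
    {u : N.N →ₗ[K] N'.N} {v : N'.N →ₗ[K] N.N} (hu : Equivariant N N' u)
    (hv : Equivariant N' N v) (hvu : v ∘ₗ u = LinearMap.id) (huv : u ∘ₗ v = LinearMap.id) :
    ∃ e : A.N ≃ₗ[K] A'.N, ∀ a, e (A.x a) = A'.x (e a) := by
  obtain ⟨fA, i, r, hi, hr, hri, hc⟩ := hA
  obtain ⟨fA', i', r', hi', hr', hri', hc'⟩ := hA'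
  refine ⟨LinearEquiv.ofLinearMap (r' ∘ₗ u ∘ₗ i) (r ∘ₗ v ∘ₗ i') ?_ ?_,
    fun a => hr'.comp (hu.comp hi) a⟩
  · ext a
    have h1 := hc A' fA' (v ∘ₗ i') (hv.comp hi') a
    simp only [LinearMap.comp_apply] at h1
    simp only [LinearMap.comp_apply, h1]
    rw [← LinearMap.comp_apply u v, huv]
    exact LinearMap.congr_fun hri' a
  · ext a
    have h1 := hc' A fA (u ∘ₗ i) (hu.comp hi) a
    simp only [LinearMap.comp_apply] at h1
    simp only [LinearMap.comp_apply, h1]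
    rw [← LinearMap.comp_apply v u, hvu]
    exact LinearMap.congr_fun hri a

/-- The product of a family of spaces with automorphism. -/
abbrev AutSpace.pi {ι : Type} (A : ι → AutSpace K) : AutSpace K where
  N := ∀ i, (A i).N
  x := LinearEquiv.piCongrRight fun i => (A i).x

lemma isCoker_pi {ι : Type} [Finite ι] {τ : ι → Pair K} {A : ι → AutSpace K}
    {g : ∀ i, (τ i).V →ₗ[K] (A i).N} (hg : ∀ i, IsCoker (τ i).mu (τ i).nu (A i) (g i)) :
    IsCoker (LinearMap.pi fun i => (τ i).mu ∘ₗ LinearMap.proj i)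
      (LinearMap.pi fun i => (τ i).nu ∘ₗ LinearMap.proj i) (AutSpace.pi A)
      (LinearMap.pi fun i => g i ∘ₗ LinearMap.proj i) := by
  classical
  have := Fintype.ofFinite ι
  refine ⟨fun e => funext fun i => (hg i).1 (e i), fun P f hf => ?_⟩
  have key : ∀ i, Coequalizes (τ i).mu (τ i).nu P
      (f ∘ₗ LinearMap.single K (fun i => (τ i).V) i) := by
    intro i e
    have := hf (Pi.single i e : ∀ i, (τ i).E)
    have h1 : (LinearMap.pi fun i => (τ i).mu ∘ₗ LinearMap.proj i) (Pi.single i e : ∀ i, (τ i).E)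
        = (Pi.single i ((τ i).mu e) : ∀ i, (τ i).V) := by
      funext j
      exact (Pi.apply_single (fun i => (τ i).mu) (fun i => map_zero _) i e j)
    have h2 : (LinearMap.pi fun i => (τ i).nu ∘ₗ LinearMap.proj i) (Pi.single i e : ∀ i, (τ i).E)
        = (Pi.single i ((τ i).nu e) : ∀ i, (τ i).V) := by
      funext j
      exact (Pi.apply_single (fun i => (τ i).nu) (fun i => map_zero _) i e j)
    rw [h1, h2] at this
    exact this
  choose h hh hu using fun i => (hg i).2 P _ (key i)
  refine ⟨∑ i, h i ∘ₗ (LinearMap.proj i : (∀ i, (A i).N) →ₗ[K] _), ⟨?_, ?_⟩, ?_⟩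
  · intro v
    simp only [LinearMap.sum_apply, map_sum, LinearMap.comp_apply]
    exact Finset.sum_congr rfl fun i _ => (hh i).1 (v i)
  · refine LinearMap.pi_ext' (M := P.N) (φ := fun i => (τ i).V) fun i => ?_
    rw [← (hh i).2]
    ext v
    simp only [LinearMap.comp_apply, LinearMap.sum_apply]
    rw [Finset.sum_eq_single i]
    · simp
    · intro j _ hj
      simp [hj]
    · simp
  · rintro k ⟨hk, hkf⟩
    refine LinearMap.pi_ext' (M := P.N) (φ := fun i => (A i).N) fun i => ?_
    have : (k : (∀ i, (A i).N) →ₗ[K] P.N) ∘ₗ LinearMap.single K (fun i => (A i).N) i = h i := by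
      refine hu i _ ⟨fun v => ?_, ?_⟩
      · have := hk (Pi.single i v : ∀ i, (A i).N)
        have h1 : (AutSpace.pi A).x (Pi.single i v : ∀ i, (A i).N)
            = (Pi.single i ((A i).x v) : ∀ i, (A i).N) := by
          funext j
          exact (Pi.apply_single (fun i => (A i).x) (fun i => map_zero _) i v j)
        rw [h1] at this
        exact this
      · ext v
        have h1 := LinearMap.congr_fun hkf (Pi.single i v : ∀ i, (τ i).V)
        have h2 : (LinearMap.pi fun i => g i ∘ₗ LinearMap.proj i : (∀ i, (τ i).V) →ₗ[K] _)
            (Pi.single i v : ∀ i, (τ i).V) = (Pi.single i (g i v) : ∀ i, (A i).N) := by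
          funext j
          exact (Pi.apply_single (fun i => g i) (fun i => map_zero _) i v j)
        exact (congrArg k h2.symm).trans h1
    rw [this]
    ext v
    simp only [LinearMap.comp_apply, LinearMap.sum_apply]
    rw [Finset.sum_eq_single i]
    · simp
    · intro j _ hj
      simp [hj]
    · simp

/-- Spaces with automorphism receiving no nonzero map from a finite-dimensional one. -/
def IsFree (N : AutSpace K) : Prop :=
  ∀ (B : AutSpace K), FiniteDimensional K B.N → ∀ φ : B.N →ₗ[K] N.N, Equivariant B N φ → φ = 0

lemma isCore_pi {ι : Type} [Finite ι] (A : ι → AutSpace K) (p : ι → Prop)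
    (h1 : ∀ i, p i → FiniteDimensional K (A i).N) (h2 : ∀ i, ¬ p i → IsFree (A i)) :
    IsCore (AutSpace.pi A) (AutSpace.pi fun i : {i // p i} => A i.1) := by
  classical
  have := fun i : {i // p i} => h1 i.1 i.2
  refine ⟨inferInstanceAs (FiniteDimensional K (∀ i : {i // p i}, (A i.1).N)),
    LinearMap.pi fun i => if h : p i then LinearMap.proj (⟨i, h⟩ : {i // p i}) else 0,
    LinearMap.pi fun i => LinearMap.proj i.1, ?_, fun v => rfl, ?_, ?_⟩
  · intro v
    funext i
    by_cases h : p i <;> simp [AutSpace.pi, h]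
  · refine LinearMap.ext fun v => funext fun i => ?_
    simp [i.2]
  · intro B fB φ hφ b
    funext i
    by_cases h : p i
    · simp [h]
    · have := h2 i h B fB (LinearMap.proj i ∘ₗ φ) (fun v => congrFun (hφ v) i)
      simpa [h] using (LinearMap.congr_fun this b).symm

end AutSpace

section PermSpace

variable {K}

variable (K) in
/-- The permutation module of a permutation. -/
noncomputable abbrev permSpace {Z : Type} (π : Equiv.Perm Z) : AutSpace K where
  N := Z →₀ K
  x := Finsupp.domLCongr π

lemma permSpace_apply_eq_zero {Z : Type} {π : Equiv.Perm Z} {B : AutSpace K}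
    [FiniteDimensional K B.N] {φ : B.N →ₗ[K] (permSpace K π).N}
    (hφ : Equivariant B (permSpace K π) φ) {z : Z}
    (hz : ∀ T : Finset Z, ∃ k : ℕ, (π ^ k) z ∉ T) (b : B.N) :
    (φ b : Z →₀ K) z = 0 := by
  classical
  let β := Module.finBasis K B.N
  let T : Finset Z := Finset.univ.biUnion fun i => (φ (β i) : Z →₀ K).support
  have hT : ∀ b, (φ b : Z →₀ K) ∈ Finsupp.supported K K (T : Set Z) := by
    have : ⊤ ≤ (Finsupp.supported K K (T : Set Z)).comap φ := by
      rw [← β.span_eq, Submodule.span_le]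
      rintro _ ⟨i, rfl⟩
      rw [SetLike.mem_coe, Submodule.mem_comap, Finsupp.mem_supported]
      intro z hz
      exact Finset.mem_biUnion.2 ⟨i, Finset.mem_univ _, hz⟩
    exact fun b => this (Submodule.mem_top)
  have hk : ∀ (k : ℕ) (b : B.N), ∃ b', (φ b' : Z →₀ K) ((π ^ k) z) = (φ b : Z →₀ K) z := by
    intro k
    induction k with
    | zero => exact fun b => ⟨b, rfl⟩
    | succ k ih =>
      intro b
      obtain ⟨b', hb'⟩ := ih b
      refine ⟨B.x b', ?_⟩
      rw [hφ b', ← hb', pow_succ', Equiv.Perm.mul_apply]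
      change (Finsupp.domLCongr π (φ b' : Z →₀ K) : Z →₀ K) _ = _
      simp
  obtain ⟨k, hk'⟩ := hz T
  obtain ⟨b', hb'⟩ := hk k b
  rw [← hb']
  by_contra h0
  exact hk' ((Finsupp.mem_supported K _).1 (hT b') (Finsupp.mem_support_iff.2 h0))

/-- `(Z, π)` with `g : S → Z` is the universal permuted set with `g (s e) = π (g (t e))` for
all edges `e`. -/
def IsHull {R S Z : Type} (s t : R → S) (π : Equiv.Perm Z) (g : S → Z) : Prop :=
  (∀ e, g (s e) = π (g (t e))) ∧
    ∀ (P : Type) (y : Equiv.Perm P) (f : S → P), (∀ e, f (s e) = y (f (t e))) →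
      ∃! h : Z → P, (∀ z, h (π z) = y (h z)) ∧ h ∘ g = f

lemma IsHull.isCoker {R S Z : Type} {s t : R → S} {π : Equiv.Perm Z} {g : S → Z}
    (hg : IsHull s t π g) {E V : Type} [AddCommGroup E] [Module K E]
    [AddCommGroup V] [Module K V] {mu nu : E →ₗ[K] V} (bE : Module.Basis R K E)
    (bV : Module.Basis S K V)
    (hmu : ∀ e, mu (bE e) = bV (s e)) (hnu : ∀ e, nu (bE e) = bV (t e)) :
    ∃ g', IsCoker mu nu (permSpace K π) g' := by
  have hx : ∀ z, (permSpace K π).x (Finsupp.single z 1 : Z →₀ K)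
      = (Finsupp.single (π z) 1 : Z →₀ K) := fun z => Finsupp.domLCongr_single _ _ _
  have hG : ∀ v, (bV.constr K fun v => (Finsupp.single (g v) 1 : Z →₀ K)) (bV v)
      = Finsupp.single (g v) 1 := fun v => bV.constr_basis K _ _
  refine ⟨bV.constr K fun v => (Finsupp.single (g v) 1 : Z →₀ K), fun e => ?_, fun P f hf => ?_⟩
  · suffices h : (bV.constr K fun v => (Finsupp.single (g v) 1 : Z →₀ K)) ∘ₗ mu
        = (permSpace K π).x.toLinearMap ∘ₗ
          (bV.constr K fun v => (Finsupp.single (g v) 1 : Z →₀ K)) ∘ₗ nu from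
      LinearMap.congr_fun h e
    refine bE.ext fun e => ?_
    simp only [LinearMap.comp_apply, hmu, hnu]
    rw [hG, hG, hg.1]
    exact (hx _).symm
  · obtain ⟨h, ⟨hh, hhg⟩, hu⟩ := hg.2 P.N P.x.toEquiv (fun v => f (bV v)) (fun e => by
      simpa [hmu, hnu] using hf (bE e))
    have hH : ∀ z, Finsupp.linearCombination K h (Finsupp.single z 1) = h z := by simp
    refine ⟨Finsupp.linearCombination K h, ⟨fun v => ?_, ?_⟩, ?_⟩
    · suffices h : Finsupp.linearCombination K h ∘ₗ (permSpace K π).x.toLinearMap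
          = P.x.toLinearMap ∘ₗ Finsupp.linearCombination K h from LinearMap.congr_fun h v
      refine Finsupp.lhom_ext' fun z => LinearMap.ext_ring ?_
      have h1 := congrArg (Finsupp.linearCombination K h) (hx z)
      refine h1.trans ?_
      rw [hH, hh]
      simp
    · refine bV.ext fun v => ?_
      rw [LinearMap.comp_apply, hG, hH]
      exact congrFun hhg v
    · rintro k ⟨hk, hkf⟩
      have : (fun z => k (Finsupp.single z 1 : Z →₀ K)) = h := by
        refine hu _ ⟨fun z => ?_, funext fun v => ?_⟩
        · have := hk (Finsupp.single z 1 : Z →₀ K)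
          rw [hx] at this
          exact this
        · have := LinearMap.congr_fun hkf (bV v)
          rw [LinearMap.comp_apply, hG] at this
          exact this
      refine Finsupp.lhom_ext' fun z => LinearMap.ext_ring ?_
      refine (congrFun this z).trans ?_
      simp

end PermSpace

section Hull

/-- `(Z, π)` is the universal permuted set of the relation `Γ`. -/
def HasHull (Γ : BRel) {Z : Type} (π : Equiv.Perm Z) : Prop :=
  ∃ g : Γ.S → Z, IsHull (fun e : {p : Γ.S × Γ.S // Γ.R p.1 p.2} => e.1.1) (fun e => e.1.2) π g

variable {Z : Type} {π : Equiv.Perm Z}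

lemma HasHull.of_iso {Γ Δ : BRel} (h : BRel.Iso Γ Δ) (hΔ : HasHull Δ π) : HasHull Γ π := by
  obtain ⟨φ, hφ⟩ := h
  obtain ⟨g, hg, hu⟩ := hΔ
  refine ⟨g ∘ φ, fun e => hg ⟨(φ e.1.1, φ e.1.2), (hφ _ _).2 e.2⟩, fun P y f hf => ?_⟩
  obtain ⟨h, ⟨hh, hhf⟩, huu⟩ := hu P y (f ∘ φ.symm) (fun e =>
    hf ⟨(φ.symm e.1.1, φ.symm e.1.2), (hφ _ _).1 (by simpa using e.2)⟩)
  refine ⟨h, ⟨hh, ?_⟩, fun k hk => huu k ⟨hk.1, ?_⟩⟩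
  · rw [← Function.comp_assoc, hhf, Function.comp_assoc]
    simp
  · rw [← hk.2, Function.comp_assoc, Function.comp_assoc]
    simp

lemma HasHull.of_quotBy {Γ : BRel} {r : Γ.S → Γ.S → Prop}
    (hr : ∀ (P : Type) (y : Equiv.Perm P) (f : Γ.S → P), (∀ a b, Γ.R a b → f a = y (f b)) →
      ∀ a b, r a b → f a = f b)
    (h : HasHull (Γ.quotBy r) π) : HasHull Γ π := by
  obtain ⟨g, hg, hu⟩ := h
  refine ⟨fun a => g (Quot.mk r a),
    fun e => hg ⟨(Quot.mk r e.1.1, Quot.mk r e.1.2), _, _, rfl, rfl, e.2⟩, fun P y f hf => ?_⟩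
  obtain ⟨h, ⟨hh, hhf⟩, huu⟩ := hu P y (Quot.lift f (hr P y f fun a b hab => hf ⟨(a, b), hab⟩)) (by
    rintro ⟨⟨u, v⟩, h⟩
    obtain ⟨a, b, h1, h2, hab⟩ := id h
    change Quot.lift f _ u = y (Quot.lift f _ v)
    simp only at h1 h2
    simp only [← h1, ← h2]
    exact hf ⟨(a, b), hab⟩)
  refine ⟨h, ⟨hh, funext fun a => congrFun hhf (Quot.mk r a)⟩, fun k hk => huu k ⟨hk.1, ?_⟩⟩
  funext a
  induction a using Quot.ind with
  | mk a => exact congrFun hk.2 a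

lemma HasHull.of_Cl {Γ : BRel} (h : HasHull Γ.Cl π) : HasHull Γ π :=
  HasHull.of_quotBy (fun _ y _ hf a b ⟨x, ha, hb⟩ =>
    y.injective ((hf x a ha).symm.trans (hf x b hb))) h

lemma HasHull.of_Cr {Γ : BRel} (h : HasHull Γ.Cr π) : HasHull Γ π :=
  HasHull.of_quotBy (fun _ _ _ hf a b ⟨x, ha, hb⟩ => (hf a x ha).trans (hf b x hb).symm) h

lemma HasHull.of_iterate {F : BRel → BRel} (hF : ∀ Γ, HasHull (F Γ) π → HasHull Γ π) (n : ℕ) :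
    ∀ Γ, HasHull (F^[n] Γ) π → HasHull Γ π := by
  induction n with
  | zero => exact fun _ => id
  | succ n ih => exact fun Γ h => hF Γ (ih _ h)

/-- Translation by one on a disjoint union of copies of `ℤ`. -/
def shiftPerm (I : Type) : Equiv.Perm (I × ℤ) :=
  (Equiv.refl I).prodCongr (Equiv.addRight 1)

/-- Backward rotation of a disjoint union of cycles. -/
def cyclePerm {q : ℕ} (c : Fin q → ℕ) : Equiv.Perm (Σ j, Fin (c j)) :=
  (Equiv.sigmaCongrRight fun j => finRotate (c j)).symm

lemma eq_zpow_neg_apply {P : Type} (y : Equiv.Perm P) (u : ℕ → P) (n : ℕ)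
    (h : ∀ a < n, u a = y (u (a + 1))) : ∀ a ≤ n, u a = (y ^ (-(a : ℤ))) (u 0) := by
  intro a
  induction a with
  | zero => simp
  | succ a ih =>
    intro ha
    have h1 := h a ha
    rw [ih (by lia)] at h1
    rw [← y.symm_apply_eq.2 h1, Nat.cast_succ, neg_add_rev, zpow_add, Equiv.Perm.mul_apply,
      zpow_neg_one]
    rfl

lemma apply_zpow_of_commute {P Q : Type} {y : Equiv.Perm P} {x : Equiv.Perm Q} {h : Q → P}
    (hh : ∀ z, h (x z) = y (h z)) (k : ℤ) (z : Q) : h ((x ^ k) z) = (y ^ k) (h z) := by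
  induction k with
  | zero => simp
  | succ k ih => rw [add_comm, zpow_add, zpow_add, Equiv.Perm.mul_apply, Equiv.Perm.mul_apply,
      zpow_one, zpow_one, hh, ih]
  | pred k ih =>
    rw [sub_eq_add_neg, add_comm, zpow_add, zpow_add, Equiv.Perm.mul_apply, Equiv.Perm.mul_apply,
      zpow_neg_one, zpow_neg_one, ← ih, Equiv.Perm.eq_inv_iff_eq, ← hh, ← Equiv.Perm.mul_apply,
      mul_inv_cancel, Equiv.Perm.one_apply]

lemma shiftPerm_zpow_apply {I : Type} (i : I) (k l : ℤ) :
    (shiftPerm I ^ k) (i, l) = (i, l + k) := by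
  induction k with
  | zero => simp
  | succ k ih => rw [add_comm, zpow_add, Equiv.Perm.mul_apply, ih, zpow_one]
                 simp [shiftPerm]
                 ring
  | pred k ih =>
    rw [sub_eq_add_neg, add_comm, zpow_add, Equiv.Perm.mul_apply, ih, zpow_neg_one,
      Equiv.Perm.inv_eq_iff_eq]
    simp [shiftPerm]
    ring

lemma exists_shiftPerm_pow_notMem {I : Type} (z : I × ℤ) (T : Finset (I × ℤ)) :
    ∃ k : ℕ, (shiftPerm I ^ k) z ∉ T := by
  by_contra! h
  refine Set.infinite_univ (α := ℕ) (Set.Finite.subset (T.finite_toSet.preimage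
    (f := fun k : ℕ => (shiftPerm I ^ k) z) ?_) fun k _ => h k)
  intro a _ b _ hab
  simp only [← zpow_natCast] at hab
  rw [shiftPerm_zpow_apply, shiftPerm_zpow_apply] at hab
  simpa using hab

/-- The permutation of the hull of a disjoint union of paths and cycles. -/
abbrev modelPerm (p : ℕ) {q : ℕ} (c : Fin q → ℕ) : Equiv.Perm ((Fin p × ℤ) ⊕ (Σ j, Fin (c j))) :=
  (shiftPerm (Fin p)).sumCongr (cyclePerm c)

lemma val_finRotate {n : ℕ} (a : Fin n) : (finRotate n a : ℕ) = ((a : ℕ) + 1) % n := by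
  obtain _ | n := n
  · exact a.elim0
  · rw [finRotate_apply, Fin.val_add]
    simp

lemma cyclePerm_apply_eq {q : ℕ} (c : Fin q → ℕ) (j : Fin q) (a b : Fin (c j))
    (h : (b : ℕ) = ((a : ℕ) + 1) % c j) : cyclePerm c ⟨j, b⟩ = ⟨j, a⟩ := by
  have : finRotate (c j) a = b := Fin.ext ((val_finRotate a).trans h.symm)
  rw [cyclePerm, Equiv.symm_apply_eq]
  simp [this]

lemma hasHull_modelGraph (p q : ℕ) (m : Fin p → ℕ) (c : Fin q → ℕ) (hm : ∀ i, 1 ≤ m i) :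
    HasHull (modelGraph p q m c) (modelPerm p c) := by
  refine ⟨Sum.map (fun v => (v.1, -(v.2 : ℤ))) id, ?_, fun P y f hf => ?_⟩
  · rintro ⟨⟨u, v⟩, h⟩
    obtain ⟨i, a, b, h1, h2, hab⟩ | ⟨j, a, b, h1, h2, hab⟩ := id h <;>
      simp only at h1 h2 <;> simp only [h1, h2]
    · simp [hab, shiftPerm]
    · simp [cyclePerm_apply_eq c j a b hab]
  · have hpath : ∀ i (a : Fin (m i)),
        f (Sum.inl ⟨i, a⟩) = (y ^ (-(a : ℤ))) (f (Sum.inl ⟨i, ⟨0, hm i⟩⟩)) := by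
      intro i a
      have := eq_zpow_neg_apply y
        (fun k => if h : k < m i then f (Sum.inl ⟨i, ⟨k, h⟩⟩) else f (Sum.inl ⟨i, a⟩)) (m i - 1)
        (fun k hk => by
          have h1 : k < m i := by lia
          have h2 : k + 1 < m i := by lia
          simp only [h1, h2, dif_pos]
          exact hf ⟨(Sum.inl ⟨i, ⟨k, h1⟩⟩, Sum.inl ⟨i, ⟨k + 1, h2⟩⟩),
            Or.inl ⟨i, _, _, rfl, rfl, rfl⟩⟩) a (by lia)
      simpa [show 0 < m i from hm i] using this
    refine ⟨Sum.elim (fun z => (y ^ z.2) (f (Sum.inl ⟨z.1, ⟨0, hm z.1⟩⟩))) (fun z => f (Sum.inr z)),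
      ⟨?_, ?_⟩, ?_⟩
    · rintro (⟨i, k⟩ | ⟨j, b⟩)
      · simp [shiftPerm, add_comm k, zpow_add]
      · obtain ⟨⟨j', a⟩, h⟩ : ∃ z, cyclePerm c ⟨j, b⟩ = z := ⟨_, rfl⟩
        have h2 := h
        rw [cyclePerm, Equiv.symm_apply_eq] at h2
        simp only [Equiv.sigmaCongrRight_apply, Sigma.mk.injEq] at h2
        obtain ⟨rfl, h2⟩ := h2
        simp only [heq_eq_eq] at h2
        simp only [Equiv.sumCongr_apply, Sum.map_inr, Sum.elim_inr, h]
        refine hf ⟨(Sum.inr ⟨j, a⟩, Sum.inr ⟨j, b⟩), Or.inr ⟨j, a, b, rfl, rfl, ?_⟩⟩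
        rw [h2, val_finRotate]
    · funext v
      obtain ⟨i, a⟩ | v := v
      · exact (hpath i a).symm
      · rfl
    · rintro k ⟨hk, hkf⟩
      funext z
      obtain ⟨i, l⟩ | v := z
      · have h1 := congrFun hkf (Sum.inl ⟨i, ⟨0, hm i⟩⟩)
        have h2 := apply_zpow_of_commute (h := fun z => k (Sum.inl z)) (x := shiftPerm (Fin p))
          (y := y) (fun z => hk (Sum.inl z)) l (i, 0)
        rw [shiftPerm_zpow_apply, zero_add] at h2
        rw [Sum.elim_inl, ← h1]
        refine h2.trans ?_
        simp
        rfl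
      · exact congrFun hkf (Sum.inr v)

lemma hasHull_of_contraction {Γ : BRel} {N p q : ℕ} {m : Fin p → ℕ} {c : Fin q → ℕ}
    (hm : ∀ i, 1 ≤ m i) (h : BRel.Iso (BRel.Cl^[N] (BRel.Cr^[N] Γ)) (modelGraph p q m c)) :
    HasHull Γ (modelPerm p c) :=
  HasHull.of_iterate (fun _ => HasHull.of_Cr) N _
    (HasHull.of_iterate (fun _ => HasHull.of_Cl) N _
      (HasHull.of_iso h (hasHull_modelGraph p q m c hm)))

variable {K}

lemma isCoker_linz {Γ : BRel} (h : HasHull Γ π) :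
    ∃ g, IsCoker (Γ.linz K).mu (Γ.linz K).nu (permSpace K π) g := by
  classical
  obtain ⟨g, hg⟩ := h
  let i1 := Fintype.ofFinite Γ.S
  refine hg.isCoker (Pi.basisFun K {p : Γ.S × Γ.S // Γ.R p.1 p.2}) (Pi.basisFun K Γ.S) ?_ ?_
  all_goals
    intro e
    refine (congrArg _ (Pi.basisFun_apply K _ e)).trans ?_
    refine ((Matrix.toLin'_apply _ _).trans ?_).trans (Pi.basisFun_apply K _ _).symm
    funext v
    simp [Matrix.mulVec, dotProduct, Pi.single_apply, eq_comm]

lemma isCore_modelPerm (p q : ℕ) (c : Fin q → ℕ) :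
    IsCore (permSpace K (modelPerm p c)) (permSpace K (cyclePerm c)) := by
  classical
  refine ⟨inferInstanceAs (FiniteDimensional K ((Σ j, Fin (c j)) →₀ K)),
    Finsupp.lmapDomain K K Sum.inr, LinearMap.snd K _ _ ∘ₗ
      (Finsupp.sumFinsuppLEquivProdFinsupp K).toLinearMap, ?_, ?_, ?_, ?_⟩
  · intro v
    induction v using Finsupp.induction_linear with
    | zero => simp
    | add v w hv hw => simp only [map_add, hv, hw]
    | single z k => simp [permSpace]
  · intro v
    ext z
    simp [permSpace]
  · ext z
    simp
  · intro B fB φ hφ b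
    ext z
    obtain z | z := z
    · refine Eq.trans ?_ (permSpace_apply_eq_zero hφ (fun T => ?_) b).symm
      · exact Finsupp.mapDomain_of_notMem_range _ _ (by simp)
      · obtain ⟨k, hk⟩ := exists_shiftPerm_pow_notMem z (T.preimage Sum.inl Sum.inl_injective.injOn)
        refine ⟨k, fun h => hk (Finset.mem_preimage.2 ?_)⟩
        convert h using 1
        clear h hk
        induction k with
        | zero => rfl
        | succ k ih => rw [pow_succ', pow_succ', Equiv.Perm.mul_apply, Equiv.Perm.mul_apply, ← ih]
                       rfl
    · simp [Finsupp.mapDomain_apply Sum.inr_injective]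

end Hull

section Kronecker

variable {K}

section Unbundled

variable {E V : Type} [AddCommGroup E] [Module K E] [AddCommGroup V] [Module K V]

lemma exists_isCoker_isFree_of_forall_eq_zero {mu nu : E →ₗ[K] V}
    (h : ∀ (P : AutSpace K) (f : V →ₗ[K] P.N), Coequalizes mu nu P f → f = 0) :
    ∃ (A : AutSpace K) (g : _), IsCoker mu nu A g ∧ IsFree A :=
  ⟨⟨PUnit, LinearEquiv.refl K _⟩, 0,
    ⟨fun _ => rfl, fun P f hf => ⟨0, ⟨fun v => by simp, by simp [h P f hf]⟩,
      fun k _ => LinearMap.ext fun v => by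
        rw [show v = 0 from Subsingleton.elim (α := PUnit) _ _]
        simp⟩⟩,
    fun _ _ _ _ => LinearMap.ext fun _ => rfl⟩

end Unbundled

variable (K) in
/-- The `k`-th standard vector of `K^n`, which is zero for `k ≥ n`. -/
def stdVec (n k : ℕ) : Fin n → K := fun j => if (j : ℕ) = k then 1 else 0

lemma stdVec_of_le {n k : ℕ} (h : n ≤ k) : stdVec K n k = 0 :=
  funext fun j => if_neg (by lia)

lemma single_eq_stdVec {n : ℕ} (i : Fin n) : (Pi.single i 1 : Fin n → K) = stdVec K n i := by
  funext j
  simp [stdVec, Pi.single_apply, Fin.ext_iff]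

lemma eq_zero_of_stdVec {n : ℕ} {P : Type} [AddCommGroup P] [Module K P]
    {f : (Fin n → K) →ₗ[K] P} (h : ∀ i < n, f (stdVec K n i) = 0) : f = 0 :=
  (Pi.basisFun K (Fin n)).ext fun i => by
    rw [Pi.basisFun_apply, single_eq_stdVec, h i i.2, LinearMap.zero_apply]

lemma eq_zero_of_stdVec_succ {n : ℕ} {P : Type} [AddCommGroup P] [Module K P]
    {f : (Fin n → K) →ₗ[K] P}
    (h : ∀ i < n, f (stdVec K n (i + 1)) = 0 → f (stdVec K n i) = 0) : f = 0 := by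
  refine eq_zero_of_stdVec fun i hi => ?_
  refine Nat.decreasingInduction (motive := fun i _ => f (stdVec K n i) = 0)
    (fun k hk => h k hk) ?_ hi.le
  rw [stdVec_of_le le_rfl, map_zero]

lemma toLin'_of_stdVec {a b : ℕ} (M : Fin b → Fin a → K) {i : ℕ} (hi : i < a) :
    Matrix.toLin' (Matrix.of M) (stdVec K a i) = fun j => M j ⟨i, hi⟩ := by
  rw [← single_eq_stdVec ⟨i, hi⟩, Matrix.toLin'_apply, Matrix.mulVec_single_one]
  rfl

lemma exists_isCoker_isFree_zT (n : ℕ) :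
    ∃ (A : AutSpace K) (g : _), IsCoker (zT K n).mu (zT K n).nu A g ∧ IsFree A := by
  refine exists_isCoker_isFree_of_forall_eq_zero fun P f hf =>
    eq_zero_of_stdVec_succ (f := f) fun i hi h0 => ?_
  have h1 : (zT K n).mu (stdVec K n i) = stdVec K n (i + 1) := by
    refine (toLin'_of_stdVec _ hi).trans (funext fun j => ?_)
    simp [stdVec, eq_comm]
  have h2 : (zT K n).nu (stdVec K n i) = stdVec K n i := by
    refine (Matrix.toLin'_apply _ _).trans ?_
    simp
  have h := hf (stdVec K n i)
  rw [h1, h2] at h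
  exact (LinearEquiv.map_eq_zero_iff P.x).1 (h.symm.trans h0)

lemma exists_isCoker_isFree_Tz (n : ℕ) :
    ∃ (A : AutSpace K) (g : _), IsCoker (Tz K n).mu (Tz K n).nu A g ∧ IsFree A := by
  refine exists_isCoker_isFree_of_forall_eq_zero fun P f hf =>
    eq_zero_of_stdVec_succ (f := f) fun i hi h0 => ?_
  have h1 : (Tz K n).nu (stdVec K n i) = stdVec K n (i + 1) := by
    refine (toLin'_of_stdVec _ hi).trans (funext fun j => ?_)
    simp [stdVec, eq_comm]
  have h2 : (Tz K n).mu (stdVec K n i) = stdVec K n i := by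
    refine (Matrix.toLin'_apply _ _).trans ?_
    simp
  have h := hf (stdVec K n i)
  rw [h1, h2] at h
  exact h.trans ((congrArg P.x h0).trans (map_zero _))

lemma exists_isCoker_isFree_zTz (n : ℕ) :
    ∃ (A : AutSpace K) (g : _), IsCoker (zTz K n).mu (zTz K n).nu A g ∧ IsFree A := by
  refine exists_isCoker_isFree_of_forall_eq_zero fun P f hf =>
    eq_zero_of_stdVec (f := f) fun i => ?_
  have h1 : ∀ i < n, (zTz K n).mu (stdVec K (n + 1) i) = stdVec K n i := fun i hi => by
    refine (toLin'_of_stdVec _ (by lia : i < n + 1)).trans (funext fun j => ?_)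
    simp [stdVec]
  induction i with
  | zero =>
    intro hi
    have h2 : (zTz K n).nu (stdVec K (n + 1) 0) = 0 := by
      refine (toLin'_of_stdVec _ (by lia : 0 < n + 1)).trans (funext fun j => ?_)
      simp
      rfl
    have h := hf (stdVec K (n + 1) 0)
    rw [h1 0 hi, h2] at h
    exact h.trans (by simp)
  | succ i ih =>
    intro hi
    have h2 : (zTz K n).nu (stdVec K (n + 1) (i + 1)) = stdVec K n i := by
      refine (toLin'_of_stdVec _ (by lia : i + 1 < n + 1)).trans (funext fun j => ?_)
      simp [stdVec]
    have h := hf (stdVec K (n + 1) (i + 1))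
    rw [h1 _ hi, h2] at h
    exact h.trans ((congrArg P.x (ih (by lia))).trans (map_zero _))

lemma isFree_shiftPerm (I : Type) : IsFree (permSpace K (shiftPerm I)) :=
  fun _ _ _ hφ => LinearMap.ext fun b => Finsupp.ext fun z =>
    permSpace_apply_eq_zero hφ (exists_shiftPerm_pow_notMem z) b

lemma isHull_path (n : ℕ) : IsHull (Fin.castSucc : Fin n → Fin (n + 1)) Fin.succ (shiftPerm Unit)
    (fun v => ((), -(v : ℤ))) := by
  refine ⟨fun e => by simp [shiftPerm], fun P y f hf => ?_⟩
  have hpath : ∀ a : Fin (n + 1), f a = (y ^ (-(a : ℤ))) (f 0) := by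
    intro a
    have := eq_zpow_neg_apply y (fun k => if h : k < n + 1 then f ⟨k, h⟩ else f a) n
      (fun k hk => by
        have h1 : k < n + 1 := by lia
        have h2 : k + 1 < n + 1 := by lia
        simp only [h1, h2, dif_pos]
        exact hf ⟨k, hk⟩) a (by lia)
    simpa using this
  refine ⟨fun z => (y ^ z.2) (f 0), ⟨?_, funext fun a => (hpath a).symm⟩, ?_⟩
  · rintro ⟨i, k⟩
    simp [shiftPerm, add_comm k, zpow_add]
  · rintro k ⟨hk, hkf⟩
    funext ⟨i, l⟩
    have h1 := congrFun hkf 0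
    have h2 := apply_zpow_of_commute hk l ((), 0)
    rw [shiftPerm_zpow_apply, zero_add] at h2
    refine h2.trans ?_
    rw [← h1]
    simp

lemma exists_isCoker_isFree_Tn (n : ℕ) :
    ∃ (A : AutSpace K) (g : _), IsCoker (Tn K n).mu (Tn K n).nu A g ∧ IsFree A := by
  obtain ⟨g, hg⟩ := (isHull_path n).isCoker (mu := (Tn K n).mu) (nu := (Tn K n).nu)
    (Pi.basisFun K (Fin n)) (Pi.basisFun K (Fin (n + 1)))
    (fun e => by
      refine (congrArg _ ((Pi.basisFun_apply K _ e).trans (single_eq_stdVec e))).trans ?_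
      refine ((toLin'_of_stdVec _ e.2).trans ?_).trans (Pi.basisFun_apply K _ _).symm
      funext j
      simp [Pi.single_apply, Fin.ext_iff])
    (fun e => by
      refine (congrArg _ ((Pi.basisFun_apply K _ e).trans (single_eq_stdVec e))).trans ?_
      refine ((toLin'_of_stdVec _ e.2).trans ?_).trans (Pi.basisFun_apply K _ _).symm
      funext j
      simp [Pi.single_apply, Fin.ext_iff])
  exact ⟨_, g, hg, isFree_shiftPerm Unit⟩

lemma isUnit_root {F : K[X]} (h : IsCoprime X F) : IsUnit (AdjoinRoot.root F) := by
  obtain ⟨a, b, hab⟩ := h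
  refine IsUnit.of_mul_eq_one_right (AdjoinRoot.mk F a) ?_
  have := congrArg (AdjoinRoot.mk F) hab
  simpa using this

/-- A pair isomorphic to `[A.x, I : A.N → A.N]`. -/
def IsEndo (τ : Pair K) (A : AutSpace K) : Prop :=
  ∃ (α : τ.E ≃ₗ[K] A.N) (β : τ.V ≃ₗ[K] A.N),
    (∀ e, A.x (α e) = β (τ.mu e)) ∧ ∀ e, α e = β (τ.nu e)

lemma IsEndo.isCoker {τ : Pair K} {A : AutSpace K} (h : IsEndo τ A) :
    ∃ g, IsCoker τ.mu τ.nu A g := by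
  obtain ⟨α, β, h1, h2⟩ := h
  refine ⟨β.toLinearMap, fun e => by simp [← h1, ← h2], fun P f hf => ?_⟩
  refine ⟨f ∘ₗ β.symm.toLinearMap, ⟨fun v => ?_, by ext; simp⟩, fun k hk => ?_⟩
  · obtain ⟨e, rfl⟩ := α.surjective v
    simp only [LinearMap.comp_apply, LinearEquiv.coe_coe]
    rw [h1, h2]
    simpa using hf e
  · rw [← hk.2]
    ext
    simp

lemma IsSType.exists_isEndo {τ : Pair K} (h : IsSType K τ) :
    ∃ A, IsEndo τ A := by
  obtain ⟨p, n, hp, hi, hX, hn, h0, α, β, h1, h2⟩ := h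
  have hc : IsCoprime X (p ^ n) := by
    refine IsCoprime.pow_right ((irreducible_X.coprime_iff_not_dvd).2 fun hd => hX ?_)
    exact (eq_of_monic_of_associated monic_X hp
      ((irreducible_X.dvd_irreducible_iff_associated hi).1 hd)).symm
  let x : AdjoinRoot (p ^ n) ≃ₗ[K] AdjoinRoot (p ^ n) :=
    LinearEquiv.ofBijective (LinearMap.mulLeft K (AdjoinRoot.root (p ^ n)))
      (IsUnit.isUnit_iff_mulLeft_bijective.1 (isUnit_root hc))
  exact ⟨⟨AdjoinRoot (p ^ n), x⟩, α, β, h1, h2⟩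

lemma IsKron.exists_isCoker {τ : Pair K} (h : IsKron K τ) :
    ∃ (A : AutSpace K) (g : _), IsCoker τ.mu τ.nu A g ∧ (IsSType K τ → IsEndo τ A) ∧
      (¬ IsSType K τ → IsFree A) := by
  by_cases hS : IsSType K τ
  · obtain ⟨A, hA⟩ := hS.exists_isEndo
    obtain ⟨g, hg⟩ := hA.isCoker
    exact ⟨A, g, hg, fun _ => hA, fun h => (h hS).elim⟩
  · have key : ∀ σ : Pair K, Pair.Iso K τ σ →
        (∃ (A : AutSpace K) (g : _), IsCoker σ.mu σ.nu A g ∧ IsFree A) →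
        ∃ (A : AutSpace K) (g : _), IsCoker τ.mu τ.nu A g ∧ (IsSType K τ → IsEndo τ A) ∧
          (¬ IsSType K τ → IsFree A) := by
      rintro σ hσ ⟨A, g, hg, hf⟩
      obtain ⟨g', hg'⟩ := IsCoker.of_iso hσ hg
      exact ⟨A, g', hg', fun h => (hS h).elim, fun _ => hf⟩
    obtain ⟨n, -, h⟩ | ⟨n, -, h⟩ | ⟨n, h⟩ | ⟨n, h⟩ | h := h
    · exact key _ h (exists_isCoker_isFree_zT n)
    · exact key _ h (exists_isCoker_isFree_Tz n)
    · exact key _ h (exists_isCoker_isFree_Tn n)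
    · exact key _ h (exists_isCoker_isFree_zTz n)
    · exact (hS h).elim

lemma exists_basis_adjoinRoot {c : ℕ} (hc : 1 ≤ c) :
    ∃ b : Module.Basis (Fin c) K (AdjoinRoot (X ^ c - 1 : K[X])),
      ∀ a, AdjoinRoot.root _ * b (finRotate c a) = b a := by
  have hF : (X ^ c - 1 : K[X]) ≠ 0 := by
    simpa using X_pow_sub_C_ne_zero hc (1 : K)
  have hdim : (AdjoinRoot.powerBasis hF).dim = c := by
    rw [AdjoinRoot.powerBasis_dim]
    simpa using natDegree_X_pow_sub_C (n := c) (r := (1 : K))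
  have hroot : (AdjoinRoot.root (X ^ c - 1 : K[X])) ^ c = 1 := by
    rw [← sub_eq_zero, ← AdjoinRoot.mk_X, ← map_pow, ← map_one (AdjoinRoot.mk _), ← map_sub,
      AdjoinRoot.mk_self]
  refine ⟨(AdjoinRoot.powerBasis hF).basis.reindex ((finCongr hdim).trans Fin.revPerm), fun a => ?_⟩
  simp only [Module.Basis.reindex_apply, PowerBasis.basis_eq_pow, AdjoinRoot.powerBasis_gen]
  rw [← pow_succ']
  simp only [Equiv.symm_trans_apply, finCongr_symm, finCongr_apply, Fin.val_cast, Fin.revPerm_symm,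
    Fin.revPerm_apply, Fin.val_rev, val_finRotate]
  obtain h | h : (a : ℕ) + 1 = c ∨ (a : ℕ) + 1 < c := by lia
  · rw [h, Nat.mod_self, Nat.sub_self, show c - (0 + 1) + 1 = c by lia, hroot, pow_zero]
  · rw [Nat.mod_eq_of_lt h]
    congr 1
    lia

lemma exists_cyclePerm_equiv {q : ℕ} {c : Fin q → ℕ} (hc : ∀ j, 1 ≤ c j) :
    ∃ e : ((Σ j, Fin (c j)) →₀ K) ≃ₗ[K] (∀ j, AdjoinRoot (X ^ c j - 1 : K[X])),
      ∀ v j, AdjoinRoot.root _ * e v j = e ((permSpace K (cyclePerm c)).x v) j := by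
  classical
  choose b hb using fun j => exists_basis_adjoinRoot (K := K) (hc j)
  refine ⟨(Pi.basis b).repr.symm, fun v j => ?_⟩
  induction v using Finsupp.induction_linear with
  | zero => simp
  | add v w hv hw => simp only [map_add, Pi.add_apply, mul_add, hv, hw]
  | single z k =>
    obtain ⟨z, rfl⟩ := (cyclePerm c).symm.surjective z
    obtain ⟨i, a⟩ := z
    have h1 : (permSpace K (cyclePerm c)).x
        (Finsupp.single ((cyclePerm c).symm ⟨i, a⟩) k : (Σ j, Fin (c j)) →₀ K)
          = (Finsupp.single ⟨i, a⟩ k : (Σ j, Fin (c j)) →₀ K) := by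
      simp [permSpace]
    have h2 : (cyclePerm c).symm ⟨i, a⟩ = ⟨i, finRotate (c i) a⟩ := rfl
    rw [h1, h2, Module.Basis.repr_symm_single, Module.Basis.repr_symm_single, Pi.smul_apply,
      Pi.smul_apply, mul_smul_comm, Pi.basis_apply, Pi.basis_apply]
    congr 1
    obtain rfl | hij := eq_or_ne j i
    · rw [Pi.single_eq_same, Pi.single_eq_same, hb]
    · rw [Pi.single_eq_of_ne hij, Pi.single_eq_of_ne hij, mul_zero]

end Kronecker

/-- If the C-stabilization of `Γ` has cycle components
`C_{n_1}, …, C_{n_q}`, then the direct sum of the summands of type `S(p^n)` in a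
Kronecker decomposition of `K(Γ)` is isomorphic to `⊕_{j=1}^q S(X^{n_j} − 1)`. -/
theorem stmt11 (K : Type) [Field K] (Γ : BRel) (N : ℕ) (hN : Γ.StabAt N)
    (p q : ℕ) (mm : Fin p → ℕ) (cc : Fin q → ℕ)
    (hm : ∀ i, 1 ≤ mm i) (hc : ∀ j, 1 ≤ cc j)
    (hdec : BRel.Iso (BRel.Cl^[N] (BRel.Cr^[N] Γ)) (modelGraph p q mm cc))
    (k : ℕ) (τ : Fin k → Pair K) (hτ : ∀ i, IsKron K (τ i))
    (h : Pair.Iso K (Γ.linz K) (dSum K (Fin k) τ)) :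
    Pair.Iso K (dSum K {i : Fin k // IsSType K (τ i)} (fun i => τ i.1))
      (dSum K (Fin q) fun j =>
        SP K (X ^ (cc j) - 1)
          (by simpa using Polynomial.X_pow_sub_C_ne_zero (hc j) (1 : K))) := by

  choose A g hg hE hF using fun i => (hτ i).exists_isCoker
  obtain ⟨g₁, hg₁⟩ := IsCoker.of_iso h (isCoker_pi hg)
  obtain ⟨g₂, hg₂⟩ := isCoker_linz (K := K) (hasHull_of_contraction hm hdec)
  obtain ⟨u, v, hu, hv, hvu, huv⟩ := hg₁.unique hg₂
  choose α β hα hβ using fun i : {i : Fin k // IsSType K (τ i)} => hE i.1 i.2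
  have hcore := isCore_pi A (fun i => IsSType K (τ i))
    (fun i hi => Module.Finite.equiv (α ⟨i, hi⟩)) hF
  obtain ⟨e, he⟩ := hcore.unique (isCore_modelPerm p q cc) hu hv hvu huv
  obtain ⟨ε, hε⟩ := exists_cyclePerm_equiv (K := K) hc
  refine ⟨(LinearEquiv.piCongrRight α).trans (e.trans ε),
    (LinearEquiv.piCongrRight β).trans (e.trans ε), fun x => funext fun j => ?_,
    fun x => funext fun j => ?_⟩
  · refine (hε _ j).trans (congrFun (congrArg ε ?_) j)
    exact (he _).symm.trans (congrArg e (funext fun i => hα i (x i)))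
  · exact congrFun (congrArg (fun w => ε (e w)) (funext fun i => hβ i (x i))) j

end Towber
end

section
/- Let K be a field and let τ = [μ,ν : E → V] be a transformation-pair over K which is isomorphic to a finite direct sum of members of Kronecker's list L(K). Then the number of summands isomorphic to ^0T^0_0 = [0,0 : K → 0] in this decomposition equals dim_K(Ker μ ∩ Ker ν). -/
open Polynomial

namespace Towber

variable (K : Type) [Field K]

/-- The common kernel `Ker μ ∩ Ker ν` of a transformation-pair. -/
def Pair.commonKer (τ : Pair K) : Submodule K τ.E :=
  LinearMap.ker τ.mu ⊓ LinearMap.ker τ.nu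

variable {K}

theorem Pair.mem_commonKer {τ : Pair K} {x : τ.E} :
    x ∈ τ.commonKer ↔ τ.mu x = 0 ∧ τ.nu x = 0 := by
  simp [Pair.commonKer]

theorem Pair.Iso.finrank_commonKer_eq {τ σ : Pair K} (h : Pair.Iso K τ σ) :
    Module.finrank K τ.commonKer = Module.finrank K σ.commonKer := by
  obtain ⟨α, β, hμ, hν⟩ := h
  have hmap : τ.commonKer.map (α : τ.E →ₗ[K] σ.E) = σ.commonKer := by
    ext y
    rw [Submodule.mem_map_equiv, Pair.mem_commonKer, Pair.mem_commonKer,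
      ← α.apply_symm_apply y, hμ, hν]
    simp
  rw [← hmap]
  exact (α.submoduleMap τ.commonKer).finrank_eq

theorem Pair.finrank_commonKer_eq_zero {τ : Pair K}
    (h : ∀ x, τ.mu x = 0 → τ.nu x = 0 → x = 0) : Module.finrank K τ.commonKer = 0 := by
  have hbot : τ.commonKer = ⊥ := by
    rw [Submodule.eq_bot_iff]
    intro x hx
    rw [Pair.mem_commonKer] at hx
    exact h x hx.1 hx.2
  rw [hbot, finrank_bot]

/-- The common kernel of a finite direct sum is the product of the common kernels. -/
noncomputable def commonKerDSumEquiv {ι : Type} [Finite ι] (σ : ι → Pair K) :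
    (dSum K ι σ).commonKer ≃ₗ[K] (∀ i, (σ i).commonKer) where
  toFun x i := ⟨x.1 i, Pair.mem_commonKer.2
    ⟨congrFun (Pair.mem_commonKer.1 x.2).1 i, congrFun (Pair.mem_commonKer.1 x.2).2 i⟩⟩
  invFun y := ⟨fun i => (y i).1, Pair.mem_commonKer.2
    ⟨funext fun i => (Pair.mem_commonKer.1 (y i).2).1,
      funext fun i => (Pair.mem_commonKer.1 (y i).2).2⟩⟩
  map_add' _ _ := rfl
  map_smul' _ _ := rfl
  left_inv _ := rfl
  right_inv _ := rfl

theorem finrank_commonKer_dSum {ι : Type} [Fintype ι] (σ : ι → Pair K) :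
    Module.finrank K (dSum K ι σ).commonKer =
      ∑ i, Module.finrank K (σ i).commonKer := by
  rw [(commonKerDSumEquiv σ).finrank_eq, Module.finrank_pi_fintype]

theorem finrank_commonKer_zT (n : ℕ) : Module.finrank K (zT K n).commonKer = 0 := by
  refine Pair.finrank_commonKer_eq_zero fun (x : Fin n → K) _ hν => ?_
  change Matrix.toLin' 1 x = 0 at hν
  rwa [Matrix.toLin'_one] at hν

theorem finrank_commonKer_Tz (n : ℕ) : Module.finrank K (Tz K n).commonKer = 0 := by
  refine Pair.finrank_commonKer_eq_zero fun (x : Fin n → K) hμ _ => ?_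
  change Matrix.toLin' 1 x = 0 at hμ
  rwa [Matrix.toLin'_one] at hμ

theorem finrank_commonKer_Tn (n : ℕ) : Module.finrank K (Tn K n).commonKer = 0 := by
  refine Pair.finrank_commonKer_eq_zero fun (x : Fin n → K) hμ _ => ?_
  change Matrix.toLin' _ x = 0 at hμ
  funext i
  have hi := congrFun hμ i.castSucc
  change x i = 0
  simpa [Matrix.toLin'_apply, Matrix.mulVec, dotProduct, ← Fin.ext_iff] using hi

theorem finrank_commonKer_zTz_succ (n : ℕ) :
    Module.finrank K (zTz K (n + 1)).commonKer = 0 := by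
  refine Pair.finrank_commonKer_eq_zero fun (x : Fin (n + 2) → K) hμ hν => ?_
  change Matrix.toLin' _ x = 0 at hμ hν
  funext i
  induction i using Fin.lastCases with
  | last =>
    have hi := congrFun hν (Fin.last n)
    change x (Fin.last (n + 1)) = 0
    simpa [Matrix.toLin'_apply, Matrix.mulVec, dotProduct, Fin.sum_univ_castSucc,
      (Fin.is_lt _).ne'] using hi
  | cast i =>
    have hi := congrFun hμ i
    change x i.castSucc = 0
    simpa [Matrix.toLin'_apply, Matrix.mulVec, dotProduct, Fin.sum_univ_castSucc,
      ← Fin.ext_iff, i.is_lt.ne] using hi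

theorem finrank_commonKer_SP (F : Polynomial K) (hF : F ≠ 0) :
    Module.finrank K (SP K F hF).commonKer = 0 :=
  Pair.finrank_commonKer_eq_zero fun _ _ hν => hν

theorem finrank_commonKer_zTz_zero : Module.finrank K (zTz K 0).commonKer = 1 := by
  have htop : (zTz K 0).commonKer = ⊤ := by
    rw [eq_top_iff]
    intro x _
    rw [Pair.mem_commonKer]
    exact ⟨funext fun i : Fin 0 => i.elim0, funext fun i : Fin 0 => i.elim0⟩
  rw [htop, finrank_top]
  change Module.finrank K (Fin 1 → K) = 1
  simp

open Classical in
theorem IsKron.finrank_commonKer {σ : Pair K} (hσ : IsKron K σ) :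
    Module.finrank K σ.commonKer = if Pair.Iso K σ (zTz K 0) then 1 else 0 := by
  split_ifs with h
  · rw [h.finrank_commonKer_eq, finrank_commonKer_zTz_zero]
  · obtain ⟨n, -, hn⟩ | ⟨n, -, hn⟩ | ⟨n, hn⟩ | ⟨n, hn⟩ | ⟨p, n, -, -, -, -, hp, hn⟩ := hσ
    · rw [hn.finrank_commonKer_eq, finrank_commonKer_zT]
    · rw [hn.finrank_commonKer_eq, finrank_commonKer_Tz]
    · rw [hn.finrank_commonKer_eq, finrank_commonKer_Tn]
    · cases n with
      | zero => exact absurd hn h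
      | succ n => rw [hn.finrank_commonKer_eq, finrank_commonKer_zTz_succ]
    · rw [hn.finrank_commonKer_eq, finrank_commonKer_SP]

/-- The multiplicity of `^0T^0_0 = [0,0 : K → 0]` in a Kronecker
decomposition of `τ` equals `dim (ker μ ∩ ker ν)`. -/
theorem stmt13 (K : Type) [Field K] (τ : Pair K) (k : ℕ) (σ : Fin k → Pair K)
    (hσ : ∀ i, IsKron K (σ i)) (h : Pair.Iso K τ (dSum K (Fin k) σ)) :
    Nat.card {i : Fin k // Pair.Iso K (σ i) (zTz K 0)} =
      Module.finrank K ↥(LinearMap.ker τ.mu ⊓ LinearMap.ker τ.nu) := by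
  classical
  change _ = Module.finrank K τ.commonKer
  rw [h.finrank_commonKer_eq, finrank_commonKer_dSum,
    Finset.sum_congr rfl fun i _ => (hσ i).finrank_commonKer, Finset.sum_boole,
    Nat.card_eq_fintype_card, Fintype.card_subtype, Nat.cast_id]

end Towber
end
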